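/- For every δ > 0 there exists n₀ ∈ ℕ such that for all n > n₀, the Shannon depth function for reversible circuits without additional inputs satisfies D(n,0) ≥ (1/3 − δ)·2ⁿ/log₂ n. -/

import Mathlib

namespace RevCirc

/-- A reversible gate on `n` wires: a target coordinate together with a set of
at most two control coordinates not containing the target.  With no controls it
is a NOT gate, with one control a CNOT gate and with two controls a 2-CNOT
(Toffoli) gate. -/
abbrev Gate (n : ℕ) : Type :=
  {p : Fin n × Finset (Fin n) // p.2.card ≤ 2 ∧ p.1 ∉ p.2}

def Gate.target {n : ℕ} (g : Gate n) : Fin n := g.1.1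

def Gate.controls {n : ℕ} (g : Gate n) : Finset (Fin n) := g.1.2

/-- The transformation of `ℤ₂ⁿ` defined by a gate: the target coordinate is
XOR-ed with the conjunction of the control coordinates. -/
def Gate.apply {n : ℕ} (g : Gate n) (x : Fin n → Bool) : Fin n → Bool :=
  fun i => if i = g.target then xor (x i) (decide (∀ j ∈ g.controls, x j = true)) else x i

/-- The transformation defined by a circuit (a list of gates, applied left to right). -/
def evalCircuit {n : ℕ} (c : List (Gate n)) (x : Fin n → Bool) : Fin n → Bool :=
  c.foldl (fun y g => g.apply y) x

/-- A circuit realizes a permutation `h` of `ℤ₂ⁿ` (without additional inputs) if the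
composition of its gates equals `h`. -/
def realizes {n : ℕ} (c : List (Gate n)) (h : Equiv.Perm (Fin n → Bool)) : Prop :=
  ∀ x, evalCircuit c x = h x

/-- The expanding function `ℤ₂ⁿ → ℤ₂^{n+q}` padding with zeros. -/
def expand (n q : ℕ) (x : Fin n → Bool) : Fin (n + q) → Bool :=
  fun i => if h : (i : ℕ) < n then x ⟨i, h⟩ else false

/-- A circuit with `n+q` inputs implements `f : ℤ₂ⁿ → ℤ₂ⁿ` using `q` additional
inputs if for some permutation `π` of the wires, the coordinates `π(1),…,π(n)` of the
output on the zero-padded input give `f`. -/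
def implements (n q : ℕ) (c : List (Gate (n + q)))
    (f : (Fin n → Bool) → (Fin n → Bool)) : Prop :=
  ∃ π : Equiv.Perm (Fin (n + q)), ∀ x : Fin n → Bool, ∀ i : Fin n,
    evalCircuit c (expand n q x) (π (Fin.castLE (Nat.le_add_right n q) i)) = f x i

/-- `F(n,q)`: the set of transformations `ℤ₂ⁿ → ℤ₂ⁿ` implementable by reversible
circuits with `n+q` inputs. -/
def FSet (n q : ℕ) : Set ((Fin n → Bool) → (Fin n → Bool)) :=
  {f | ∃ c : List (Gate (n + q)), implements n q c f}

/-- The set of wires touched by a gate: its target together with its controls. -/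
def Gate.support {n : ℕ} (g : Gate n) : Finset (Fin n) := insert g.target g.controls

/-- A circuit has depth 1 if the supports of its gates are pairwise disjoint. -/
def DepthOne {n : ℕ} (c : List (Gate n)) : Prop :=
  c.Pairwise fun g₁ g₂ => Disjoint g₁.support g₂.support

/-- The depth of a circuit: the minimal number of consecutive depth-1 sub-circuits
into which it can be divided. -/
noncomputable def depth {n : ℕ} (c : List (Gate n)) : ℕ :=
  sInf {d | ∃ parts : List (List (Gate n)),
    parts.flatten = c ∧ (∀ p ∈ parts, DepthOne p) ∧ parts.length = d}

/-- The quantum weight of a circuit: each NOT and CNOT gate weighs `WC`, each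
2-CNOT gate weighs `WT`. -/
def weight {n : ℕ} (WC WT : ℝ) (c : List (Gate n)) : ℝ :=
  (c.map fun g => if g.controls.card = 2 then WT else WC).sum

/-- `L(f,q)`: minimal gate complexity of a circuit implementing `f` with `q`
additional inputs. -/
noncomputable def Lmin (n q : ℕ) (f : (Fin n → Bool) → (Fin n → Bool)) : ℕ :=
  sInf {l | ∃ c : List (Gate (n + q)), implements n q c f ∧ c.length = l}

/-- The Shannon gate complexity function `L(n,q)`. -/
noncomputable def ShannonL (n q : ℕ) : ℕ := sSup (Lmin n q '' FSet n q)

/-- `D(f,q)`: minimal depth of a circuit implementing `f` with `q` additional inputs. -/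
noncomputable def Dmin (n q : ℕ) (f : (Fin n → Bool) → (Fin n → Bool)) : ℕ :=
  sInf {d | ∃ c : List (Gate (n + q)), implements n q c f ∧ depth c = d}

/-- The Shannon depth function `D(n,q)`. -/
noncomputable def ShannonD (n q : ℕ) : ℕ := sSup (Dmin n q '' FSet n q)

/-- `W(f,q)`: minimal quantum weight of a circuit implementing `f` with `q`
additional inputs. -/
noncomputable def Wmin (WC WT : ℝ) (n q : ℕ) (f : (Fin n → Bool) → (Fin n → Bool)) : ℝ :=
  sInf {w | ∃ c : List (Gate (n + q)), implements n q c f ∧ weight WC WT c = w}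

/-- The Shannon quantum weight function `W(n,q)`. -/
noncomputable def ShannonW (WC WT : ℝ) (n q : ℕ) : ℝ := sSup (Wmin WC WT n q '' FSet n q)

/-- A permutation is a product of `K` pairwise disjoint (independent) transpositions:
there are `2K` pairwise distinct points `x i, y i` with `g = (x 1, y 1)∘⋯∘(x K, y K)`. -/
def IsProdOfDisjointTranspositions {X : Type*} [DecidableEq X] (K : ℕ)
    (g : Equiv.Perm X) : Prop :=
  ∃ x y : Fin K → X,
    Function.Injective (Sum.elim x y) ∧
    g = ((List.finRange K).map fun i => Equiv.swap (x i) (y i)).prod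

end RevCirc


namespace RevCirc

/-- Generalised multiply-controlled NOT. -/
def ctl {n : ℕ} (S : Finset (Fin n)) (k : Fin n) (x : Fin n → Bool) : Fin n → Bool :=
  fun i => if i = k then xor (x i) (decide (∀ j ∈ S, x j = true)) else x i

theorem ctl_invol {n : ℕ} (S : Finset (Fin n)) (k : Fin n) (hk : k ∉ S) :
    Function.Involutive (ctl S k) := by
  intro x
  have h : ∀ j ∈ S, ctl S k x j = x j := by
    intro j hj
    have : j ≠ k := fun h => hk (h ▸ hj)
    simp [ctl, this]
  have h2 : (∀ j ∈ S, ctl S k x j = true) ↔ (∀ j ∈ S, x j = true) :=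
    forall₂_congr fun j hj => by rw [h j hj]
  funext i
  by_cases hi : i = k
  · have : ctl S k (ctl S k x) i = xor (ctl S k x i) (decide (∀ j ∈ S, ctl S k x j = true)) := by
      rw [ctl, if_pos hi]
    have h3 : decide (∀ j ∈ S, ctl S k x j = true) = decide (∀ j ∈ S, x j = true) :=
      decide_eq_decide.2 h2
    rw [this, h3]
    simp [ctl, hi]
  · simp [ctl, hi]

def ctlPerm {n : ℕ} (S : Finset (Fin n)) (k : Fin n) (hk : k ∉ S) :
    Equiv.Perm (Fin n → Bool) := (ctl_invol S k hk).toPerm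

theorem ctlPerm_apply {n : ℕ} (S : Finset (Fin n)) (k : Fin n) (hk : k ∉ S) (x : Fin n → Bool) :
    ctlPerm S k hk x = ctl S k x := rfl

/-- The group generated by the gates. -/
def gateGroup (n : ℕ) : Subgroup (Equiv.Perm (Fin n → Bool)) :=
  Subgroup.closure {p | ∃ (S : Finset (Fin n)) (k : Fin n) (hk : k ∉ S), S.card ≤ 2 ∧
    p = ctlPerm S k hk}

theorem gate_mem {n : ℕ} (S : Finset (Fin n)) (k : Fin n) (hk : k ∉ S) (h : S.card ≤ 2) :
    ctlPerm S k hk ∈ gateGroup n := Subgroup.subset_closure ⟨S, k, hk, h, rfl⟩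

theorem evalCircuit_append {n : ℕ} (c d : List (Gate n)) (x : Fin n → Bool) :
    evalCircuit (c ++ d) x = evalCircuit d (evalCircuit c x) := by
  simp [evalCircuit]

theorem evalCircuit_cons {n : ℕ} (g : Gate n) (d : List (Gate n)) (x : Fin n → Bool) :
    evalCircuit (g :: d) x = evalCircuit d (g.apply x) := by
  simp [evalCircuit]

theorem evalCircuit_nil {n : ℕ} (x : Fin n → Bool) :
    evalCircuit [] x = x := by
  simp [evalCircuit]

theorem gate_apply_invol {n : ℕ} (g : Gate n) (x : Fin n → Bool) : g.apply (g.apply x) = x :=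
  ctl_invol g.controls g.target g.2.2 x

theorem evalCircuit_reverse {n : ℕ} (c : List (Gate n)) (x : Fin n → Bool) :
    evalCircuit c (evalCircuit c.reverse x) = x := by
  induction c generalizing x with
  | nil => simp [evalCircuit]
  | cons g c ih =>
    rw [List.reverse_cons, evalCircuit_append, evalCircuit_cons, evalCircuit_cons, evalCircuit_nil,
      gate_apply_invol, ih]

theorem exists_circuit {n : ℕ} (p : Equiv.Perm (Fin n → Bool)) (hp : p ∈ gateGroup n) :
    ∃ c : List (Gate n), ∀ x, evalCircuit c x = p x := by
  induction hp using Subgroup.closure_induction with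
  | mem p h =>
    obtain ⟨S, k, hk, hS, rfl⟩ := h
    exact ⟨[⟨(k, S), hS, hk⟩], fun x => rfl⟩
  | one => exact ⟨[], fun x => rfl⟩
  | mul a b _ _ ha hb =>
    obtain ⟨c, hc⟩ := ha
    obtain ⟨d, hd⟩ := hb
    exact ⟨d ++ c, fun x => by rw [evalCircuit_append, hd, hc]; rfl⟩
  | inv a _ ha =>
    obtain ⟨c, hc⟩ := ha
    refine ⟨c.reverse, fun x => ?_⟩
    rw [Equiv.Perm.eq_inv_iff_eq, ← hc, evalCircuit_reverse]

theorem ctl_insert {n : ℕ} (S : Finset (Fin n)) (i j k : Fin n)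
    (hkS : k ∉ S) (hjS : j ∉ S) (hij : i ≠ j) (hik : i ≠ k) (hjk : j ≠ k)
    (x : Fin n → Bool) :
    ctl (insert i S) k x = ctl S j (ctl {i, j} k (ctl S j (ctl {i, j} k x))) := by
  have key : ∀ y : Fin n → Bool, (∀ l ∈ S, y l = x l) →
      decide (∀ l ∈ S, y l = true) = decide (∀ l ∈ S, x l = true) := fun y hy =>
    decide_eq_decide.2 (forall₂_congr fun l hl => by rw [hy l hl])
  have hS : ∀ l ∈ S, l ≠ j ∧ l ≠ k := fun l hl =>
    ⟨fun h => hjS (h ▸ hl), fun h => hkS (h ▸ hl)⟩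
  have k1 : decide (∀ l ∈ S, ctl {i, j} k x l = true) = decide (∀ l ∈ S, x l = true) :=
    key _ fun l hl => by simp [ctl, hS l hl]
  have k2 : decide (∀ l ∈ S, ctl {i, j} k (ctl S j (ctl {i, j} k x)) l = true)
      = decide (∀ l ∈ S, x l = true) :=
    key _ fun l hl => by simp [ctl, hS l hl]
  have e1 : ∀ y l, ctl S j y l = if l = j then xor (y l) (decide (∀ j ∈ S, y j = true)) else y l :=
    fun _ _ => rfl
  have e2 : ∀ y l, ctl {i, j} k y l = if l = k then xor (y l) (y i && y j) else y l := by
    intro y l; simp [ctl]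
  have e3 : ctl (insert i S) k x = fun l => if l = k then
      xor (x l) (x i && decide (∀ j ∈ S, x j = true)) else x l := by
    funext l; simp [ctl]
  rw [e3]
  funext l
  rw [e1, k2]
  generalize hb : decide (∀ l ∈ S, x l = true) = b
  rw [hb] at k1
  by_cases h1 : l = k
  · subst h1
    simp only [hjk.symm, if_false, if_true, e2, e1, hij, hik, hjk]
    rw [← k1]
    simp only [e2]
    cases x l <;> cases x i <;> cases x j <;> simp
  · by_cases h2 : l = j
    · subst h2
      simp only [hjk, if_false, if_true, e2 _ l, e1, k1]
      simp
    · simp [h1, h2, e2 _ l, e1 _ l]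

theorem ctl_mem {n : ℕ} (S : Finset (Fin n)) (k : Fin n) (hk : k ∉ S) (h : S.card + 2 ≤ n) :
    ctlPerm S k hk ∈ gateGroup n := by
  induction S using Finset.induction_on generalizing k with
  | empty => exact gate_mem _ _ _ (by simp)
  | insert i S hi ih =>
    have hc := Finset.card_insert_of_notMem hi
    obtain ⟨j, hj⟩ : ∃ j, j ∉ insert k (insert i S) := by
      by_contra hcon
      push Not at hcon
      have : insert k (insert i S) = Finset.univ := Finset.eq_univ_iff_forall.2 hcon
      have h1 := Finset.card_insert_le k (insert i S)
      rw [this, Finset.card_univ, Fintype.card_fin] at h1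
      omega
    simp only [Finset.mem_insert, not_or] at hj hk
    obtain ⟨hjk, hji, hjS⟩ := hj
    have hkij : k ∉ ({i, j} : Finset (Fin n)) := by simp [hk.1, Ne.symm hjk]
    have e : ctlPerm (insert i S) k (by simp [hk]) =
        ctlPerm S j hjS * ctlPerm {i, j} k hkij * ctlPerm S j hjS * ctlPerm {i, j} k hkij := by
      ext1 x
      exact ctl_insert S i j k hk.2 hjS (Ne.symm hji) (Ne.symm hk.1) hjk x
    rw [e]
    have m1 := ih j hjS (by omega)
    have m2 := gate_mem {i, j} k hkij (Finset.card_le_two)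
    exact mul_mem (mul_mem (mul_mem m1 m2) m1) m2

theorem threeCycle_of_invol {α : Type*} [Fintype α] [DecidableEq α] (g h : Equiv.Perm α) (p : α)
    (hg : ∀ x, g (g x) = x) (hh : ∀ x, h (h x) = x) (hgp : g p ≠ p) (hhp : h p ≠ p)
    (hp : ∀ x, g x ≠ x → h x ≠ x → x = p) : (g * h * g * h).IsThreeCycle := by
  have q1 : g (h p) = h p := by
    by_contra hc
    exact hhp (hp _ hc (by rw [hh]; exact hhp.symm))
  have r1 : h (g p) = g p := by
    by_contra hc
    exact hgp (hp _ (by rw [hg]; exact hgp.symm) hc)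
  have hqr : h p ≠ g p := by
    intro hc
    rw [hc, hg] at q1
    exact hgp q1.symm
  have e : g * h * g * h = Equiv.swap p (h p) * Equiv.swap p (g p) := by
    ext1 x
    simp only [Equiv.Perm.mul_apply]
    by_cases h1 : x = p
    · subst h1
      rw [q1, hh, Equiv.swap_apply_left, Equiv.swap_apply_of_ne_of_ne hgp hqr.symm]
    by_cases h2 : x = h p
    · subst h2
      rw [hh, r1, hg, Equiv.swap_apply_of_ne_of_ne hhp hqr, Equiv.swap_apply_right]
    by_cases h3 : x = g p
    · subst h3
      rw [r1, hg, q1, Equiv.swap_apply_right, Equiv.swap_apply_left]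
    rw [Equiv.swap_apply_of_ne_of_ne h1 h3, Equiv.swap_apply_of_ne_of_ne h1 h2]
    by_cases h4 : h x = x
    · rw [h4]
      by_cases h5 : h (g x) = g x
      · rw [h5, hg]
      · exfalso
        by_cases h6 : g x = x
        · rw [h6] at h5; exact h5 h4
        · have := hp (g x) (by rw [hg]; exact Ne.symm h6) h5
          exact h3 (by rw [← this, hg])
    · have h5 : g (h x) = h x := by
        by_contra hc
        have := hp (h x) hc (by rw [hh]; exact Ne.symm h4)
        exact h2 (by rw [← this, hh])
      rw [h5, hh]
      by_contra hc
      exact h1 (hp x hc h4)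
  rw [e]
  exact Equiv.Perm.isThreeCycle_swap_mul_swap_same hhp.symm hgp.symm hqr

theorem exists_threeCycle {n : ℕ} (hn : 4 ≤ n) :
    ∃ g ∈ gateGroup n, g.IsThreeCycle := by
  let a : Fin n := ⟨0, by omega⟩
  let b : Fin n := ⟨1, by omega⟩
  let c : Fin n := ⟨2, by omega⟩
  let d : Fin n := ⟨3, by omega⟩
  have hab : a ≠ b := by simp [a, b]
  have hac : a ≠ c := by simp [a, c]
  have had : a ≠ d := by simp [a, d]
  have hbc : b ≠ c := by simp [b, c]
  have hbd : b ≠ d := by simp [b, d]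
  have hcd : c ≠ d := by simp [c, d]
  let S : Finset (Fin n) := ({a, b} : Finset (Fin n))ᶜ
  let T : Finset (Fin n) := ({c, d} : Finset (Fin n))ᶜ
  have haS : a ∉ S := by simp [S]
  have hcT : c ∉ T := by simp [T]
  have hcS : S.card + 2 ≤ n := by
    simp only [S, Finset.card_compl, Finset.card_pair hab, Fintype.card_fin]; omega
  have hcT' : T.card + 2 ≤ n := by
    simp only [T, Finset.card_compl, Finset.card_pair hcd, Fintype.card_fin]; omega
  have m1 := ctl_mem S a haS hcS
  have m2 := ctl_mem T c hcT hcT'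
  refine ⟨_, mul_mem (mul_mem (mul_mem m1 m2) m1) m2, ?_⟩
  have mv : ∀ (S : Finset (Fin n)) (k : Fin n) (x), ctl S k x ≠ x → ∀ j ∈ S, x j = true := by
    intro S k x hx
    by_contra hc
    apply hx
    funext i
    simp only [ctl, decide_eq_false hc]
    simp
  apply threeCycle_of_invol (ctlPerm S a haS) (ctlPerm T c hcT) (fun _ => true) (ctl_invol S a haS) (ctl_invol T c hcT)
  · intro h
    have := congrFun h a
    simp [ctlPerm_apply, ctl] at this
  · intro h
    have := congrFun h c
    simp [ctlPerm_apply, ctl] at this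
  · intro x h1 h2
    have h1 := mv _ _ _ h1
    have h2 := mv _ _ _ h2
    funext i
    by_cases hi : i ∈ S
    · exact h1 i hi
    · apply h2
      simp only [S, Finset.mem_compl, not_not, Finset.mem_insert, Finset.mem_singleton] at hi
      rcases hi with rfl | rfl <;> simp [T, *]

theorem multi_mem {n : ℕ} (S : Finset (Fin n)) (hS : S.card ≤ 2) (c : Fin n → Bool)
    (hc : ∀ j ∈ S, c j = false) (s : Finset (Fin n)) :
    ∃ g ∈ gateGroup n, ∀ x j, g x j =
      if j ∈ s then xor (x j) (c j && decide (∀ k ∈ S, x k = true)) else x j := by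
  induction s using Finset.induction_on with
  | empty => exact ⟨1, one_mem _, fun x j => by simp⟩
  | insert i s hi ih =>
    obtain ⟨g, hg, hgx⟩ := ih
    by_cases hci : c i = false
    · refine ⟨g, hg, fun x j => ?_⟩
      rw [hgx]
      by_cases hj : j = i
      · subst hj; simp [hi, hci]
      · simp [hj]
    · have hiS : i ∉ S := fun h => hci (hc i h)
      refine ⟨ctlPerm S i hiS * g, mul_mem (gate_mem S i hiS hS) hg, fun x j => ?_⟩
      rw [Equiv.Perm.mul_apply, ctlPerm_apply]
      have e : decide (∀ k ∈ S, g x k = true) = decide (∀ k ∈ S, x k = true) :=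
        decide_eq_decide.2 (forall₂_congr fun k hk => by
          rw [hgx]; simp [hc k hk])
      rw [ctl, e]
      by_cases hj : j = i
      · subst hj
        simp [hgx, hi, hci]
      · simp [hj, hgx]

theorem exists_norm {n : ℕ} (a b : Fin n → Bool) (hab : a ≠ b) :
    ∃ g ∈ gateGroup n, g a = (fun _ => false) ∧ g b = (fun _ => true) := by
  obtain ⟨g, hg, hgx⟩ := multi_mem (∅ : Finset (Fin n)) (by simp) a (by simp) Finset.univ
  obtain ⟨i, hi⟩ := Function.ne_iff.1 hab
  have hbi : g b i = true := by
    rw [hgx]; simp; cases h1 : a i <;> cases h2 : b i <;> simp_all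
  obtain ⟨h, hh, hhx⟩ := multi_mem ({i} : Finset (Fin n)) (by simp) (fun j => !(g b j))
    (by simp [hbi]) Finset.univ
  have ha : g a = fun _ => false := by
    funext j; rw [hgx]; simp
  refine ⟨h * g, mul_mem hh hg, ?_, ?_⟩
  · funext j
    rw [Equiv.Perm.mul_apply, hhx, ha]; simp
  · funext j
    rw [Equiv.Perm.mul_apply, hhx]; simp [hbi]

theorem alternating_le {n : ℕ} (hn : 4 ≤ n) : alternatingGroup (Fin n → Bool) ≤ gateGroup n := by
  obtain ⟨g, hg, h3⟩ := exists_threeCycle hn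
  refine Equiv.Perm.alternatingGroup_le_of_isPreprimitive_of_isThreeCycle_mem ?_ h3 hg
  apply MulAction.isPreprimitive_of_is_two_pretransitive
  rw [MulAction.is_two_pretransitive_iff]
  intro a b c d hab hcd
  obtain ⟨g, hg, h1, h2⟩ := exists_norm a b hab
  obtain ⟨h, hh, h3, h4⟩ := exists_norm c d hcd
  refine ⟨⟨h⁻¹ * g, mul_mem (inv_mem hh) hg⟩, ?_, ?_⟩
  · change h⁻¹ (g a) = c
    rw [h1, ← h3]; simp
  · change h⁻¹ (g b) = d
    rw [h2, ← h4]; simp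

/-! Layers -/

theorem eval_untouched {n : ℕ} (p : List (Gate n)) (i : Fin n) (h : ∀ g ∈ p, g.target ≠ i)
    (x : Fin n → Bool) : evalCircuit p x i = x i := by
  induction p generalizing x with
  | nil => rfl
  | cons g p ih =>
    rw [evalCircuit_cons, ih (fun g hg => h g (List.mem_cons_of_mem _ hg))]
    have := (h g (List.mem_cons_self)).symm
    simp [Gate.apply, this]

theorem eval_touched {n : ℕ} (p : List (Gate n)) (hp : DepthOne p) (g : Gate n) (hg : g ∈ p)
    (x : Fin n → Bool) : evalCircuit p x g.target =
      xor (x g.target) (decide (∀ j ∈ g.controls, x j = true)) := by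
  induction p generalizing x with
  | nil => simp at hg
  | cons h p ih =>
    rw [DepthOne, List.pairwise_cons] at hp
    rw [evalCircuit_cons]
    rcases List.mem_cons.1 hg with rfl | hg
    · rw [eval_untouched]
      · simp [Gate.apply]
      · intro g' hg' he
        have := hp.1 g' hg'
        rw [Finset.disjoint_left] at this
        exact this (a := g.target) (by simp [Gate.support]) (by simp [Gate.support, he])
    · rw [ih hp.2 hg]
      have hd := hp.1 g hg
      rw [Finset.disjoint_left] at hd
      have ht : h.target ∉ g.support := hd (by simp [Gate.support])
      have hk : ∀ j ∈ g.support, h.apply x j = x j := by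
        intro j hj
        have : j ≠ h.target := fun e => ht (e ▸ hj)
        simp [Gate.apply, this]
      rw [hk _ (by simp [Gate.support]), decide_eq_decide.2 (forall₂_congr fun j hj => by
        rw [hk j (by simp [Gate.support, hj])])]

abbrev Code (n : ℕ) : Type := Option (Option (Fin n × Fin n))

def Code.dec {n : ℕ} (x : Fin n → Bool) : Code n → Bool
  | none => false
  | some none => true
  | some (some (a, b)) => x a && x b

def layer {n : ℕ} (φ : Fin n → Code n) (x : Fin n → Bool) : Fin n → Bool :=
  fun i => xor (x i) (Code.dec x (φ i))

theorem exists_code {n : ℕ} (S : Finset (Fin n)) (hS : S.card ≤ 2) :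
    ∃ e : Code n, ∀ x : Fin n → Bool, decide (∀ j ∈ S, x j = true) = Code.dec x e := by
  have : S.card = 0 ∨ S.card = 1 ∨ S.card = 2 := by omega
  rcases this with h | h | h
  · rw [Finset.card_eq_zero] at h
    subst h
    exact ⟨some none, fun x => by simp [Code.dec]⟩
  · obtain ⟨a, rfl⟩ := Finset.card_eq_one.1 h
    exact ⟨some (some (a, a)), fun x => by simp [Code.dec]⟩
  · obtain ⟨a, b, _, rfl⟩ := Finset.card_eq_two.1 h
    exact ⟨some (some (a, b)), fun x => by simp [Code.dec]⟩

theorem exists_layer {n : ℕ} (p : List (Gate n)) (hp : DepthOne p) :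
    ∃ φ : Fin n → Code n, ∀ x, evalCircuit p x = layer φ x := by
  have : ∀ i, ∃ e : Code n, ∀ x, evalCircuit p x i = xor (x i) (Code.dec x e) := by
    intro i
    by_cases h : ∃ g ∈ p, g.target = i
    · obtain ⟨g, hg, rfl⟩ := h
      obtain ⟨e, he⟩ := exists_code g.controls g.2.1
      exact ⟨e, fun x => by rw [eval_touched p hp g hg, he]⟩
    · push Not at h
      exact ⟨none, fun x => by rw [eval_untouched p i h]; simp [Code.dec]⟩
  choose φ hφ using this
  exact ⟨φ, fun x => funext fun i => hφ i x⟩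

def evalLayers {n : ℕ} (w : List (Fin n → Code n)) (x : Fin n → Bool) : Fin n → Bool :=
  w.foldl (fun y φ => layer φ y) x

theorem exists_layers {n : ℕ} (parts : List (List (Gate n))) (h : ∀ p ∈ parts, DepthOne p) (D : ℕ)
    (hD : parts.length ≤ D) :
    ∃ w : List (Fin n → Code n), w.length = D ∧ ∀ x, evalCircuit parts.flatten x = evalLayers w x := by
  induction parts generalizing D with
  | nil =>
    refine ⟨List.replicate D (fun _ => none), by simp, fun x => ?_⟩
    have : layer (fun _ : Fin n => (none : Code n)) x = x := by
      funext i; simp [layer, Code.dec]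
    rw [List.flatten_nil, evalCircuit_nil]
    clear hD
    induction D with
    | zero => rfl
    | succ D ih =>
      rw [List.replicate_succ, evalLayers, List.foldl_cons, this]
      exact ih
  | cons p ps ih =>
    obtain ⟨D, rfl⟩ : ∃ D', D = D' + 1 := ⟨D - 1, by simp at hD; omega⟩
    obtain ⟨φ, hφ⟩ := exists_layer p (h p (by simp))
    obtain ⟨w, hw, hwx⟩ := ih (fun q hq => h q (by simp [hq])) D (by simpa using hD)
    refine ⟨φ :: w, by simp [hw], fun x => ?_⟩
    rw [List.flatten_cons, evalCircuit_append, hwx, hφ]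
    rfl

theorem depth_attained {n : ℕ} (c : List (Gate n)) : ∃ parts : List (List (Gate n)),
    parts.flatten = c ∧ (∀ p ∈ parts, DepthOne p) ∧ parts.length = depth c := by
  have : {d | ∃ parts : List (List (Gate n)),
    parts.flatten = c ∧ (∀ p ∈ parts, DepthOne p) ∧ parts.length = d}.Nonempty := by
    refine ⟨_, c.map (fun g => [g]), ?_, ?_, rfl⟩
    · induction c with
      | nil => rfl
      | cons a c ih => simp_all
    · intro p hp
      obtain ⟨g, _, rfl⟩ := List.mem_map.1 hp
      simp [DepthOne]
  exact Nat.sInf_mem this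

theorem expand_zero {n : ℕ} (x : Fin n → Bool) : expand n 0 x = x := by
  funext i
  have : (i : ℕ) < n := i.2
  simp [expand, this]

theorem mem_FSet {n : ℕ} (c : List (Gate n)) : evalCircuit c ∈ FSet n 0 := by
  refine ⟨c, 1, fun x i => ?_⟩
  rw [expand_zero]
  rfl

def decodeAll {n D : ℕ} (t : Equiv.Perm (Fin n) × List.Vector (Fin n → Code n) D) :
    (Fin n → Bool) → (Fin n → Bool) :=
  fun x i => evalLayers t.2.1 x (t.1 i)

theorem FSet_subset (n : ℕ) : FSet n 0 ⊆ Set.range (decodeAll (n := n) (D := ShannonD n 0)) := by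
  intro f hf
  have hle : Dmin n 0 f ≤ ShannonD n 0 :=
    le_csSup ((Set.toFinite (FSet n 0)).image _).bddAbove ⟨f, hf, rfl⟩
  have hne : {d | ∃ c : List (Gate (n + 0)), implements n 0 c f ∧ depth c = d}.Nonempty := by
    obtain ⟨c, hc⟩ := hf
    exact ⟨_, c, hc, rfl⟩
  obtain ⟨c, ⟨π, hπ⟩, hd⟩ := Nat.sInf_mem hne
  change depth c = Dmin n 0 f at hd
  obtain ⟨parts, h1, h2, h3⟩ := depth_attained c
  obtain ⟨w, hw, hwx⟩ := exists_layers parts h2 (ShannonD n 0) (by omega)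
  refine ⟨(π, ⟨w, hw⟩), ?_⟩
  funext x i
  have := hπ x i
  rw [expand_zero, ← h1] at this
  rw [← this]
  exact (congrFun (hwx x) (π i)).symm

theorem main_count (n : ℕ) (hn : 4 ≤ n) :
    (2 ^ n).factorial ≤ 2 * (n.factorial * ((n * n + 2) ^ n) ^ ShannonD n 0) := by
  classical
  have hinj : ∀ p : alternatingGroup (Fin n → Bool), ∃ t, decodeAll (n := n) (D := ShannonD n 0) t =
      (p : Equiv.Perm (Fin n → Bool)) := by
    intro p
    obtain ⟨c, hc⟩ := exists_circuit p.1 (alternating_le hn p.2)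
    have := FSet_subset n (mem_FSet c)
    rwa [funext hc] at this
  choose e he using hinj
  have hi : Function.Injective e := by
    intro p q hpq
    have := he p
    rw [hpq, he q] at this
    exact Subtype.ext (DFunLike.coe_injective this.symm)
  have h1 := Fintype.card_le_of_injective e hi
  have h2 : 2 * Fintype.card (alternatingGroup (Fin n → Bool)) = (2 ^ n).factorial := by
    have : Nonempty (Fin n) := ⟨⟨0, by omega⟩⟩
    have : Nontrivial (Fin n → Bool) := inferInstance
    rw [two_mul_card_alternatingGroup, Fintype.card_perm]
    simp
  rw [← h2]
  refine Nat.mul_le_mul_left 2 (h1.trans (le_of_eq ?_))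
  rw [Fintype.card_prod, card_vector, Fintype.card_perm]
  simp [Code]

theorem final_bound (n : ℕ) (hn : 24 < n) :
    (1 / 3 : ℝ) * 2 ^ n / Real.logb 2 n ≤ ShannonD n 0 := by
  have hc := main_count n (by omega)
  generalize ShannonD n 0 = D at hc ⊢
  have hnR : (24 : ℝ) < n := by exact_mod_cast hn
  have hcR : ((2 ^ n).factorial : ℝ) ≤ 2 * ((n : ℝ) ^ n * (((n : ℝ) * n + 2) ^ n) ^ D) := by
    have : (2 ^ n).factorial ≤ 2 * (n ^ n * ((n * n + 2) ^ n) ^ D) :=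
      hc.trans (Nat.mul_le_mul_left 2 (Nat.mul_le_mul_right _ (Nat.factorial_le_pow n)))
    exact_mod_cast this
  set N : ℕ := 2 ^ n with hN
  have hNR : (N : ℝ) = 2 ^ n := by simp [hN]
  have hexp := Real.pow_div_factorial_le_exp (N : ℝ) (by positivity) N
  have he : Real.exp N ≤ 4 ^ N := by
    have : Real.exp 1 ≤ 4 := by have := Real.exp_one_lt_d9; linarith
    calc Real.exp N = Real.exp 1 ^ N := by rw [← Real.exp_nat_mul, mul_one]
      _ ≤ 4 ^ N := by gcongr
  have hmain : (N : ℝ) ^ N ≤ 4 ^ N * (2 * ((n : ℝ) ^ n * (((n : ℝ) * n + 2) ^ n) ^ D)) := by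
    rw [div_le_iff₀ (by positivity)] at hexp
    exact hexp.trans (mul_le_mul he hcR (by positivity) (by positivity))
  have hN0 : (0 : ℝ) < N := by rw [hNR]; positivity
  have hn0 : (0 : ℝ) < n := by linarith
  have hm0 : (0 : ℝ) < (n : ℝ) * n + 2 := by positivity
  have hlog := Real.logb_le_logb_of_le (b := 2) (by norm_num) (by positivity) hmain
  have l4 : Real.logb 2 4 = 2 := by
    rw [show (4 : ℝ) = 2 ^ (2 : ℕ) by norm_num, Real.logb_pow]; simp
  have lN : Real.logb 2 N = n := by rw [hNR, Real.logb_pow]; simp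
  rw [Real.logb_mul (by positivity) (by positivity), Real.logb_mul (by positivity) (by positivity),
    Real.logb_mul (by positivity) (by positivity), Real.logb_pow, Real.logb_pow, Real.logb_pow,
    Real.logb_pow, Real.logb_pow, l4, lN, Real.logb_self_eq_one (by norm_num)] at hlog
  have l5 : 2 * Real.logb 2 ((n : ℝ) * n + 2) ≤ 5 * Real.logb 2 n := by
    have h : ((n : ℝ) * n + 2) ^ 2 ≤ (n : ℝ) ^ 5 := by
      have h2 : (24 : ℝ) * n ^ 4 ≤ n ^ 5 := by
        rw [pow_succ (n : ℝ) 4, mul_comm]; gcongr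
      have h3 : (1 : ℝ) ≤ (n : ℝ) ^ 2 := one_le_pow₀ (by linarith)
      have h4 : (n : ℝ) ^ 2 * 1 ≤ (n : ℝ) ^ 2 * (n : ℝ) ^ 2 := by gcongr
      nlinarith
    have := Real.logb_le_logb_of_le (b := 2) (by norm_num) (by positivity) h
    rw [Real.logb_pow, Real.logb_pow] at this
    exact_mod_cast this
  have lpos : 0 < Real.logb 2 n := Real.logb_pos (by norm_num) (by linarith)
  have ln : Real.logb 2 n ≤ n := by
    have : (n : ℝ) ≤ N := by
      have : n < 2 ^ n := Nat.lt_two_pow_self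
      exact_mod_cast this.le
    have := Real.logb_le_logb_of_le (b := 2) (by norm_num) hn0 this
    rwa [lN] at this
  have hsq : (n : ℝ) * n ≤ N := by
    have : ∀ m : ℕ, 4 ≤ m → m * m ≤ 2 ^ m := by
      intro m hm
      induction m, hm using Nat.le_induction with
      | base => norm_num
      | succ m hm ih => rw [pow_succ]; nlinarith
    exact_mod_cast this n (by omega)
  generalize Real.logb 2 (n : ℝ) = l at *
  generalize Real.logb 2 ((n : ℝ) * n + 2) = m at *
  rw [← hNR, div_le_iff₀ lpos]
  -- N n ≤ 2N + 1 + n l + D n m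
  have hD0 : (0 : ℝ) ≤ D := Nat.cast_nonneg D
  have a1 : (n : ℝ) * l ≤ N := le_trans (by gcongr) hsq
  have a2 : (D : ℝ) * (n * m) ≤ D * (n * (5 / 2 * l)) := by
    gcongr; linarith
  have a3 : (N : ℝ) * 24 ≤ N * n := by gcongr
  have a4 : (1 : ℝ) ≤ N := by nlinarith
  have a5 : (n : ℝ) * (N * (5 / 6)) ≤ n * (D * (5 / 2 * l)) := by nlinarith
  have := le_of_mul_le_mul_left a5 hn0
  nlinarith

end RevCirc

/-- Theorem: lower bound for the Shannon depth function without additional inputs: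
`D(n,0) ≥ (1/3 − δ)·2ⁿ/log₂ n` for all large `n`. -/
theorem shannonD_lower_bound_no_memory :
    ∀ δ : ℝ, 0 < δ → ∃ n₀ : ℕ, ∀ n : ℕ, n > n₀ →
      (RevCirc.ShannonD n 0 : ℝ) ≥ (1 / 3 - δ) * 2 ^ n / Real.logb 2 n := by
  intro δ hδ
  refine ⟨24, fun n hn => ?_⟩
  refine le_trans ?_ (RevCirc.final_bound n hn)
  have h1 : 0 ≤ Real.logb 2 (n : ℝ) :=
    Real.logb_nonneg (by norm_num) (by exact_mod_cast (by omega : 1 ≤ n))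
  gcongr
  linarith
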